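/- arXiv:1710.02557 — 12 statements merged into one kernel-verified Lean document; each statement's English description precedes it below -/
import Mathlib

section
/- If R is a UNC ring, then the Jacobson radical J(R) is a nil ideal of R and 2 ∈ J(R). -/
/-- An element is nil-clean if it is the sum of an idempotent and a nilpotent. -/
def IsNilClean {R : Type*} [Ring R] (a : R) : Prop :=
  ∃ e b : R, IsIdempotentElem e ∧ IsNilpotent b ∧ a = e + b

/-- A ring is a UNC ring if every unit is nil-clean. -/
def IsUNCRing (R : Type*) [Ring R] : Prop :=
  ∀ u : Rˣ, IsNilClean (u : R)

theorem exists_mul_one_add_eq_one_of_mem_jacobson_bot {R : Type*} [Ring R] {x : R}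
    (hx : x ∈ Ideal.jacobson (⊥ : Ideal R)) : ∃ z : R, z * (1 + x) = 1 := by
  obtain ⟨z, hz⟩ := Ideal.mem_jacobson_iff.1 hx 1
  refine ⟨z, ?_⟩
  rw [Ideal.mem_bot, sub_eq_zero, mul_one] at hz
  rw [mul_add, mul_one, add_comm, hz]

theorem isUnit_one_add_of_mem_jacobson_bot {R : Type*} [Ring R] {x : R}
    (hx : x ∈ Ideal.jacobson (⊥ : Ideal R)) : IsUnit (1 + x) := by
  obtain ⟨z, hz⟩ := exists_mul_one_add_eq_one_of_mem_jacobson_bot hx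
  obtain ⟨w, hw⟩ := exists_mul_one_add_eq_one_of_mem_jacobson_bot
    (neg_mem (Ideal.mul_mem_left _ z hx))
  have hz' : 1 + -(z * x) = z := by
    rw [← hz]; noncomm_ring
  rw [hz'] at hw
  have hwx : w = 1 + x := left_inv_eq_right_inv hw hz
  exact ⟨⟨1 + x, z, hwx ▸ hw, hz⟩, rfl⟩

theorem IsIdempotentElem.eq_zero_of_mem_jacobson_bot {R : Type*} [Ring R] {f : R}
    (hf : IsIdempotentElem f) (hJ : f ∈ Ideal.jacobson (⊥ : Ideal R)) : f = 0 := by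
  have hu : IsUnit (1 - f) := by
    simpa [sub_eq_add_neg] using isUnit_one_add_of_mem_jacobson_bot (neg_mem hJ)
  exact hu.mul_right_eq_zero.1 hf.one_sub_mul_self

theorem IsNilpotent.mem_jacobson_bot_of_commute {R : Type*} [Ring R] {x : R}
    (hx : IsNilpotent x) (hc : ∀ y, Commute x y) : x ∈ Ideal.jacobson (⊥ : Ideal R) := by
  refine Ideal.mem_jacobson_iff.2 fun y => ?_
  have hn : IsNilpotent (y * x) := (hc y).symm.isNilpotent_mul_left hx
  obtain ⟨z, hz⟩ := hn.isUnit_one_add.exists_left_inv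
  refine ⟨z, ?_⟩
  rw [Ideal.mem_bot, sub_eq_zero, ← hz]
  noncomm_ring

/-- In a UNC ring, every element of the Jacobson radical is nilpotent. -/
theorem IsUNCRing.isNilpotent_of_mem_jacobson_bot {R : Type*} [Ring R] (h : IsUNCRing R) {x : R}
    (hx : x ∈ Ideal.jacobson (⊥ : Ideal R)) : IsNilpotent x := by
  obtain ⟨e, b, he, ⟨n, hb⟩, hu⟩ := h (isUnit_one_add_of_mem_jacobson_bot hx).unit
  rw [IsUnit.unit_spec] at hu
  have hq : Ideal.Quotient.mk (Ideal.jacobson (⊥ : Ideal R)) (1 - e) =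
      Ideal.Quotient.mk (Ideal.jacobson (⊥ : Ideal R)) b := by
    rw [Ideal.Quotient.eq]
    have : 1 - e - b = -x := by rw [sub_sub, ← hu]; abel
    exact this ▸ neg_mem hx
  have hf : 1 - e ∈ Ideal.jacobson (⊥ : Ideal R) := by
    rw [← Ideal.Quotient.eq_zero_iff_mem, ← he.one_sub.pow_succ_eq n, map_pow, hq, ← map_pow,
      pow_succ, hb, zero_mul, map_zero]
  have he1 : 1 = e := sub_eq_zero.1 (he.one_sub.eq_zero_of_mem_jacobson_bot hf)
  rw [← he1] at hu
  exact ⟨n, by rw [add_left_cancel hu, hb]⟩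

theorem IsUNCRing.isNilpotent_two {R : Type*} [Ring R] (h : IsUNCRing R) :
    IsNilpotent (2 : R) := by
  obtain ⟨e, b, he, hb, hu⟩ := h (-1)
  rw [Units.val_neg, Units.val_one] at hu
  have heb : e = -(1 + b) := by rw [← neg_eq_iff_eq_neg, ← sub_eq_iff_eq_add.2 hu]; abel
  have hunit : IsUnit e := heb ▸ hb.isUnit_one_add.neg
  have he1 : e = 1 := hunit.mul_left_cancel (by rw [he.eq, mul_one])
  have hb2 : b = -2 := by
    rw [he1] at hu
    rw [← sub_eq_iff_eq_add'.2 hu]; norm_num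
  exact isNilpotent_neg_iff.1 (hb2 ▸ hb)

/-- If `R` is a UNC ring, then `J(R)` is nil and `2 ∈ J(R)`. -/
theorem stmt_0 (R : Type*) [Ring R] (h : IsUNCRing R) :
    (∀ x ∈ Ideal.jacobson (⊥ : Ideal R), IsNilpotent x) ∧
      (2 : R) ∈ Ideal.jacobson (⊥ : Ideal R) :=
  ⟨fun _ hx => h.isNilpotent_of_mem_jacobson_bot hx,
    h.isNilpotent_two.mem_jacobson_bot_of_commute fun y => Commute.ofNat_left 2 y⟩
end

section
/- Let I be a nil two-sided ideal of a ring R. Then R is a UNC ring if and only if the quotient ring R/I is a UNC ring. -/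
section NilKernel

variable {R S : Type*} [Ring R] [Ring S]

theorem isUnit_of_isUnit_mul_of_isUnit_mul {M : Type*} [Monoid M] {a b : M}
    (hab : IsUnit (a * b)) (hba : IsUnit (b * a)) : IsUnit a := by
  obtain ⟨c, hc⟩ := hab.exists_right_inv
  obtain ⟨d, hd⟩ := hba.exists_left_inv
  rw [mul_assoc] at hc
  rw [← mul_assoc] at hd
  exact isUnit_iff_exists.2 ⟨b * c, hc, left_inv_eq_right_inv hd hc ▸ hd⟩

/-- Units lift along a surjective ring homomorphism with nil kernel. -/
theorem RingHom.isUnit_of_isUnit_map_of_ker_isNilpotent (f : R →+* S)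
    (hf : Function.Surjective f) (h : ∀ x ∈ RingHom.ker f, IsNilpotent x) {a : R}
    (ha : IsUnit (f a)) : IsUnit a := by
  have isUnit_of_map_eq_one {x : R} (hx : f x = 1) : IsUnit x := by
    simpa using (h (x - 1) (by simp [RingHom.mem_ker, hx])).isUnit_add_one
  obtain ⟨c, hac, hca⟩ := isUnit_iff_exists.1 ha
  obtain ⟨b, rfl⟩ := hf c
  exact isUnit_of_isUnit_mul_of_isUnit_mul (isUnit_of_map_eq_one (by rw [map_mul, hac]))
    (isUnit_of_map_eq_one (by rw [map_mul, hca]))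

theorem IsNilClean.map {a : R} (ha : IsNilClean a) (f : R →+* S) : IsNilClean (f a) := by
  obtain ⟨e, b, he, hb, rfl⟩ := ha
  exact ⟨f e, f b, he.map f, hb.map f, map_add f e b⟩

theorem IsNilClean.of_map_of_ker_isNilpotent (f : R →+* S) (hf : Function.Surjective f)
    (h : ∀ x ∈ RingHom.ker f, IsNilpotent x) {a : R} (ha : IsNilClean (f a)) :
    IsNilClean a := by
  obtain ⟨e', b, he', ⟨n, hn⟩, hab⟩ := ha
  obtain ⟨e, he, rfl⟩ := exists_isIdempotentElem_eq_of_ker_isNilpotent f h e' (hf e') he'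
  refine ⟨e, a - e, he, ?_, (add_sub_cancel e a).symm⟩
  have hker : (a - e) ^ n ∈ RingHom.ker f := by
    rw [RingHom.mem_ker, map_pow, map_sub, hab, add_sub_cancel_left, hn]
  obtain ⟨m, hm⟩ := h _ hker
  exact ⟨n * m, by rw [pow_mul, hm]⟩

theorem isUNCRing_iff_of_ker_isNilpotent (f : R →+* S) (hf : Function.Surjective f)
    (h : ∀ x ∈ RingHom.ker f, IsNilpotent x) : IsUNCRing R ↔ IsUNCRing S := by
  refine ⟨fun hR u ↦ ?_, fun hS u ↦
    .of_map_of_ker_isNilpotent f hf h (hS (Units.map (f : R →* S) u))⟩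
  obtain ⟨a, ha⟩ := hf u
  have hu : IsUnit a := f.isUnit_of_isUnit_map_of_ker_isNilpotent hf h (ha ▸ u.isUnit)
  exact ha ▸ (hR hu.unit).map f

end NilKernel

/-- If `I` is a nil two-sided ideal of `R`, then `R` is a UNC ring iff `R/I` is. -/
theorem stmt_2 (R : Type*) [Ring R] (I : TwoSidedIdeal R)
    (hI : ∀ x ∈ I, IsNilpotent x) :
    IsUNCRing R ↔ IsUNCRing I.ringCon.Quotient := by
  refine isUNCRing_iff_of_ker_isNilpotent I.ringCon.mk' (RingCon.mk'_surjective _) fun x hx ↦ hI x ?_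
  rwa [← I.ker_ringCon_mk', TwoSidedIdeal.mem_ker]
end

section
/- Let R be a ring and N an (R,R)-bimodule. The trivial extension R ∝ N is a UNC ring if and only if R is a UNC ring. -/
/-- An element of a trivial extension is nil-clean iff its first component is. -/
theorem TrivSqZeroExt.isNilClean_iff_isNilClean_fst {R N : Type*} [Ring R] [AddCommGroup N]
    [Module R N] [Module Rᵐᵒᵖ N] [SMulCommClass R Rᵐᵒᵖ N] {x : TrivSqZeroExt R N} :
    IsNilClean x ↔ IsNilClean x.fst := by
  constructor
  · rintro ⟨e, b, he, hb, rfl⟩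
    exact ⟨e.fst, b.fst, congrArg fst he, isNilpotent_iff_isNilpotent_fst.mp hb, fst_add e b⟩
  · rintro ⟨e, b, he, hb, h⟩
    refine ⟨inl e, x - inl e, ?_, ?_, by abel⟩
    · rw [IsIdempotentElem, inl_mul_inl, he.eq]
    · rw [isNilpotent_iff_isNilpotent_fst, fst_sub, fst_inl, h, add_sub_cancel_left]
      exact hb

/-- The trivial extension `R ∝ N` is a UNC ring iff `R` is a UNC ring. -/
theorem stmt_3 (R N : Type*) [Ring R] [AddCommGroup N]
    [Module R N] [Module Rᵐᵒᵖ N] [SMulCommClass R Rᵐᵒᵖ N] :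
    IsUNCRing (TrivSqZeroExt R N) ↔ IsUNCRing R := by
  constructor
  · intro h u
    have hu : IsUnit (TrivSqZeroExt.inl (u : R) : TrivSqZeroExt R N) :=
      TrivSqZeroExt.isUnit_inl_iff.mpr u.isUnit
    simpa [TrivSqZeroExt.isNilClean_iff_isNilClean_fst] using h hu.unit
  · intro h u
    have hu : IsUnit (u : TrivSqZeroExt R N).fst :=
      TrivSqZeroExt.isUnit_iff_isUnit_fst.mp u.isUnit
    exact TrivSqZeroExt.isNilClean_iff_isNilClean_fst.mpr (h hu.unit)
end

section
/- If R is a nil-clean ring, then the center C(R) of R is a strongly nil-clean ring; that is, every element of C(R) is the sum of an idempotent belonging to C(R) and a nilpotent belonging to C(R). -/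
/-- An element is strongly nil-clean if it is the sum of an idempotent and a
nilpotent that commute. -/
def IsStronglyNilClean {R : Type*} [Ring R] (a : R) : Prop :=
  ∃ e b : R, IsIdempotentElem e ∧ IsNilpotent b ∧ Commute e b ∧ a = e + b

/-- In a commutative ring, an element that is idempotent modulo the nilradical is strongly
nil-clean. -/
theorem isStronglyNilClean_of_isNilpotent_sq_sub {C : Type*} [CommRing C] {a : C}
    (ha : IsNilpotent (a ^ 2 - a)) : IsStronglyNilClean a := by
  have hker : ∀ x ∈ RingHom.ker (Ideal.Quotient.mk (nilradical C)), IsNilpotent x := by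
    intro x hx
    rwa [Ideal.mk_ker, mem_nilradical] at hx
  have hidem : IsIdempotentElem (Ideal.Quotient.mk (nilradical C) a) := by
    rw [IsIdempotentElem, ← map_mul, Ideal.Quotient.eq, mem_nilradical, ← sq]
    exact ha
  obtain ⟨e, he, hea⟩ := exists_isIdempotentElem_eq_of_ker_isNilpotent
    (Ideal.Quotient.mk (nilradical C)) hker _ ⟨a, rfl⟩ hidem
  refine ⟨e, a - e, he, ?_, Commute.all _ _, by ring⟩
  rw [← mem_nilradical, ← Ideal.Quotient.eq, hea]

/-- A sum of a commuting idempotent and nilpotent differs from its square by a nilpotent. -/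
theorem IsIdempotentElem.isNilpotent_sq_sub_add {R : Type*} [Ring R] {e b : R}
    (he : IsIdempotentElem e) (hb : IsNilpotent b) (hc : Commute e b) :
    IsNilpotent ((e + b) ^ 2 - (e + b)) := by
  have key : (e + b) ^ 2 - (e + b) = (2 * e + b - 1) * b := by
    rw [hc.add_sq, he.pow_succ_eq 1]
    noncomm_ring
  rw [key]
  refine Commute.isNilpotent_mul_left ?_ hb
  exact ((((Commute.ofNat_left 2 b).mul_left hc).add_left (Commute.refl b)).sub_left
    (Commute.one_left b))

/-- If `R` is a nil-clean ring, then the center of `R` is strongly nil-clean. -/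
theorem stmt_4 (R : Type*) [Ring R] (h : ∀ a : R, IsNilClean a) :
    ∀ a : Subring.center R, IsStronglyNilClean a := by
  intro a
  apply isStronglyNilClean_of_isNilpotent_sq_sub
  obtain ⟨e, b, he, hb, hab⟩ := h a
  have hae : Commute e (a : R) := Subring.mem_center_iff.mp a.2 e
  have hc : Commute e b := by
    rw [eq_sub_of_add_eq' hab.symm]
    exact hae.sub_right (Commute.refl e)
  rw [← IsNilpotent.map_iff (f := (Subring.center R).subtype) Subtype.val_injective]
  simpa [hab] using he.isNilpotent_sq_sub_add hb hc
end

section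
/- If R is a UNC ring, then the center C(R) of R is a UU ring; that is, every unit of the ring C(R) is of the form 1 + b for some nilpotent element b of C(R). -/
/-- A ring is a UU ring if every unit is `1 +` a nilpotent. -/
def IsUURing (R : Type*) [Ring R] : Prop :=
  ∀ u : Rˣ, ∃ b : R, IsNilpotent b ∧ (u : R) = 1 + b

/-- A central unit that is nil-clean differs from `1` by a nilpotent. -/
theorem IsNilClean.isNilpotent_sub_one {R : Type*} [Ring R] {a : R} (ha : IsNilClean a)
    (hu : IsUnit a) (hc : ∀ x, Commute a x) : IsNilpotent (a - 1) := by
  obtain ⟨e, b, he, hb, rfl⟩ := ha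
  have hunit : IsUnit (-b + (e + b)) :=
    hb.neg.isUnit_add_right_of_commute hu (hc b).symm.neg_left
  rw [add_comm e b, neg_add_cancel_left] at hunit
  have h1 : e = 1 := hunit.mul_left_cancel (by rw [he.eq, mul_one])
  simpa [h1] using hb

/-- If `R` is a UNC ring, then the center of `R` is a UU ring. -/
theorem stmt_5 (R : Type*) [Ring R] (h : IsUNCRing R) :
    IsUURing (Subring.center R) := by
  intro u
  refine ⟨u - 1, ?_, by abel⟩
  have hnil : IsNilpotent ((u : Subring.center R) - 1 : R) :=
    (h (Units.map (Subring.center R).subtype.toMonoidHom u)).isNilpotent_sub_one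
      (Units.isUnit _) fun x ↦ (Subring.mem_center_iff.mp (u : Subring.center R).2 x).symm
  exact (IsNilpotent.map_iff (f := (Subring.center R).subtype) Subtype.val_injective).mp
    (by simpa using hnil)
end

section
/- A ring R is strongly nil-clean if and only if for each a ∈ R, a can be written as a = e + b, where e is an idempotent of R, b is a nilpotent of R, and eb = ebe. -/
/-- In a Peirce decomposition where `g` is triangular with respect to `e`, the corner of a power
depends only on the corner of the base. -/
theorem corner_pow_eq {R : Type*} [Ring R] {e c g : R} (hg : e * g = e * g * e)
    (hc : e * c = e * g) (n : ℕ) : e * c ^ n = e * g ^ n := by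
  have hpow : ∀ k : ℕ, e * g ^ (k + 1) = e * g ^ (k + 1) * e := by
    intro k
    induction k with
    | zero => simpa using hg
    | succ k ih =>
      calc e * g ^ (k + 1 + 1) = e * g ^ (k + 1) * g := by rw [pow_succ g (k + 1), mul_assoc]
        _ = e * g ^ (k + 1) * e * g := by rw [← ih]
        _ = e * g ^ (k + 1) * (e * g) := by rw [mul_assoc _ e g]
        _ = e * g ^ (k + 1) * (e * g * e) := by rw [← hg]
        _ = e * g ^ (k + 1) * e * g * e := by simp only [mul_assoc]
        _ = e * g ^ (k + 1) * g * e := by rw [← ih]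
        _ = e * g ^ (k + 1 + 1) * e := by rw [pow_succ g (k + 1), mul_assoc e]
  rcases n with _ | n
  · simp
  induction n with
  | zero => simpa using hc
  | succ n ih =>
    calc e * c ^ (n + 1 + 1) = e * c ^ (n + 1) * c := by rw [pow_succ c (n + 1), mul_assoc]
      _ = e * g ^ (n + 1) * e * c := by rw [ih, ← hpow]
      _ = e * g ^ (n + 1) * e * g := by rw [mul_assoc _ e c, hc, ← mul_assoc]
      _ = e * g ^ (n + 1 + 1) := by rw [← hpow, pow_succ g (n + 1), mul_assoc]

/-- The left-right dual of `corner_pow_eq`. -/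
theorem pow_corner_eq {R : Type*} [Ring R] {f c g : R} (hg : g * f = f * g * f)
    (hc : c * f = g * f) (n : ℕ) : c ^ n * f = g ^ n * f := by
  have h := corner_pow_eq (e := MulOpposite.op f) (c := MulOpposite.op c) (g := MulOpposite.op g)
    (by simp only [← MulOpposite.op_mul, ← mul_assoc, ← hg])
    (by simp only [← MulOpposite.op_mul, hc]) n
  simpa only [← MulOpposite.op_pow, ← MulOpposite.op_mul, MulOpposite.op_inj] using h

/-- A sum of an idempotent `e` and a nilpotent that is triangular with respect to `e` is
idempotent up to a nilpotent. -/
theorem isNilpotent_sub_sq_of_triangular {R : Type*} [Ring R] {e b : R} (he : IsIdempotentElem e)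
    (hb : IsNilpotent b) (heb : e * b = e * b * e) :
    IsNilpotent ((e + b) - (e + b) ^ 2) := by
  have hee : e * e = e := he
  have hebb : e * (b * b) = e * (b * b) * e := by
    calc e * (b * b) = e * b * b := (mul_assoc _ _ _).symm
      _ = e * b * (e * b) := by rw [← mul_assoc, ← heb]
      _ = e * b * (e * b * e) := by rw [← heb]
      _ = e * b * e * b * e := by simp only [mul_assoc]
      _ = e * (b * b) * e := by rw [← heb, mul_assoc e b b]
  obtain ⟨k, hk⟩ := hb
  set c := (e + b) - (e + b) ^ 2 with hcdef
  have hc : c = b - e * b - b * e - b * b := by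
    rw [hcdef, sq, add_mul, mul_add, mul_add, hee]; abel
  have hleft : e * c ^ k = 0 := by
    rw [corner_pow_eq (g := -(b * (1 + b))) _ _ k]
    · rw [neg_pow, ((Commute.one_right b).add_right (Commute.refl b)).mul_pow, hk]; simp
    · simp only [mul_neg, neg_mul, mul_add, add_mul, mul_one, ← heb, ← hebb]
    · rw [hc]
      simp only [mul_sub, mul_neg, mul_add, mul_one]
      rw [← mul_assoc e e b, hee, ← mul_assoc e b e, ← heb]; abel
  have hright : c ^ k * (1 - e) = 0 := by
    rw [pow_corner_eq (g := b * (1 - b)) _ _ k]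
    · rw [((Commute.one_right b).sub_right (Commute.refl b)).mul_pow, hk]; simp
    · have h : e * (b * (1 - b)) * (1 - e) = 0 := by
        simp only [mul_sub, sub_mul, mul_one, ← heb, ← hebb]; abel
      rw [sub_mul 1 e, one_mul, sub_mul, h, sub_zero]
    · rw [hc]
      simp only [mul_sub, sub_mul, mul_one]
      rw [mul_assoc b e e, hee, ← heb]; abel
  refine ⟨k + k, ?_⟩
  calc c ^ (k + k) = c ^ k * (1 - e) * c ^ k + c ^ k * (e * c ^ k) := by
        rw [pow_add, mul_sub, sub_mul, mul_one, mul_assoc _ e]; abel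
    _ = 0 := by rw [hright, hleft]; simp


/-- In a commutative ring, an element that is idempotent up to a nilpotent differs from an
idempotent by a nilpotent. -/
theorem exists_isIdempotentElem_isNilpotent_sub {A : Type*} [CommRing A] {x : A}
    (hx : IsNilpotent (x - x ^ 2)) : ∃ e : A, IsIdempotentElem e ∧ IsNilpotent (x - e) := by
  obtain ⟨e, he, hex⟩ := exists_isIdempotentElem_eq_of_ker_isNilpotent
    (Ideal.Quotient.mk (nilradical A)) (fun y hy ↦ by rwa [Ideal.mk_ker] at hy)
    (Ideal.Quotient.mk _ x) ⟨x, rfl⟩ (by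
      rw [IsIdempotentElem, ← map_mul, ← sq]
      exact (Ideal.Quotient.eq.2 hx).symm)
  exact ⟨e, he, Ideal.Quotient.eq.1 hex.symm⟩

open scoped IsMulCommutative in
/-- An element that is idempotent up to a nilpotent is strongly nil-clean. -/
theorem isStronglyNilClean_of_isNilpotent_sub_sq {R : Type*} [Ring R] {a : R}
    (ha : IsNilpotent (a - a ^ 2)) : IsStronglyNilClean a := by
  have : IsMulCommutative (Subring.closure {a}) := Subring.isMulCommutative_closure (by
    rintro x rfl y rfl; rfl)
  let x : Subring.closure {a} := ⟨a, Subring.subset_closure rfl⟩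
  let φ := (Subring.closure {a}).subtype
  have hφ : Function.Injective φ := Subtype.val_injective
  obtain ⟨e, he, hb⟩ := exists_isIdempotentElem_isNilpotent_sub (x := x)
    ((IsNilpotent.map_iff hφ).1 (by simpa [φ, x] using ha))
  refine ⟨φ e, φ (x - e), he.map φ, hb.map φ, (Commute.all e (x - e)).map φ, ?_⟩
  rw [← map_add, add_sub_cancel]
  rfl

/-- `R` is strongly nil-clean iff every `a ∈ R` can be written `a = e + b` with
`e` idempotent, `b` nilpotent and `eb = ebe`. -/
theorem stmt_6 (R : Type*) [Ring R] :
    (∀ a : R, IsStronglyNilClean a) ↔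
      ∀ a : R, ∃ e b : R, IsIdempotentElem e ∧ IsNilpotent b ∧
        e * b = e * b * e ∧ a = e + b := by
  refine ⟨fun h a ↦ ?_, fun h a ↦ ?_⟩
  · obtain ⟨e, b, he, hb, hcomm, rfl⟩ := h a
    refine ⟨e, b, he, hb, ?_, rfl⟩
    rw [mul_assoc, ← hcomm.eq, ← mul_assoc, he.eq]
  · obtain ⟨e, b, he, hb, heb, rfl⟩ := h a
    exact isStronglyNilClean_of_isNilpotent_sub_sq (isNilpotent_sub_sq_of_triangular he hb heb)
end

section
/- A ring R is a UU ring if and only if every unit of R is uniquely nil-clean, i.e., for every unit u of R there exists a unique idempotent e of R such that u − e is nilpotent. -/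
section UURing

variable {R : Type*} [Ring R]

theorem IsUURing.isNilpotent_sub_one (h : IsUURing R) {a : R} (ha : IsUnit a) :
    IsNilpotent (a - 1) := by
  obtain ⟨u, rfl⟩ := ha
  obtain ⟨b, hb, hu⟩ := h u
  rwa [hu, add_sub_cancel_left]

/-- With `a = x + y + x * y` and `c = x * y + y * x`, one has `a ^ 2 = c * (1 + a)`, which forces
`c`, and hence `x * y`, to be nilpotent. -/
theorem IsUURing.isNilpotent_mul_of_mul_self_eq_zero (h : IsUURing R) {x y : R}
    (hx : x * x = 0) (hy : y * y = 0) : IsNilpotent (x * y) := by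
  have hxu : IsUnit (1 + x) := IsNilpotent.isUnit_one_add ⟨2, by rw [pow_two, hx]⟩
  have hyu : IsUnit (1 + y) := IsNilpotent.isUnit_one_add ⟨2, by rw [pow_two, hy]⟩
  have hu : IsUnit (1 + x + y + x * y) := by
    have := hxu.mul hyu
    rwa [show (1 + x) * (1 + y) = 1 + x + y + x * y by noncomm_ring] at this
  obtain ⟨a, ha⟩ : ∃ a, a = x + y + x * y := ⟨_, rfl⟩
  obtain ⟨c, hc⟩ : ∃ c, c = x * y + y * x := ⟨_, rfl⟩
  have ha_nil : IsNilpotent a := by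
    have := h.isNilpotent_sub_one hu
    rwa [show 1 + x + y + x * y - 1 = a by rw [ha]; abel] at this
  have hx' (t : R) : x * (x * t) = 0 := by rw [← mul_assoc, hx, zero_mul]
  have hy' (t : R) : y * (y * t) = 0 := by rw [← mul_assoc, hy, zero_mul]
  have hcx : Commute c x := by
    simp [Commute, SemiconjBy, hc, mul_add, add_mul, mul_assoc, hx, hx']
  have hcy : Commute c y := by
    simp [Commute, SemiconjBy, hc, mul_add, add_mul, mul_assoc, hy, hy']
  have hca : Commute c a := by
    rw [ha]
    exact (hcx.add_right hcy).add_right (hcx.mul_right hcy)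
  have hsq : a ^ 2 = c * (1 + a) := by
    simp only [ha, hc, pow_two, mul_add, add_mul, mul_assoc, hx, hx', hy, mul_one, mul_zero]
    abel
  obtain ⟨n, hn⟩ := ha_nil.pow_of_pos two_ne_zero
  have hcn : c ^ n = 0 := by
    rw [hsq, ((Commute.one_right c).add_right hca).mul_pow] at hn
    exact (ha_nil.isUnit_one_add.pow n).mul_left_eq_zero.mp hn
  have hpow (m : ℕ) : c ^ m * (x * y) = (x * y) ^ (m + 1) := by
    induction m with
    | zero => simp
    | succ m ih =>
      rw [pow_succ, mul_assoc, show c * (x * y) = x * y * (x * y) by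
        simp [hc, add_mul, mul_assoc, hx'], ← mul_assoc, ih, ← pow_succ]
  exact ⟨n + 1, by rw [← hpow, hcn, zero_mul]⟩

/-- A nilpotent element with a one-sided inverse in the corner `f R f` forces `f = 0`. -/
theorem eq_zero_of_isNilpotent_of_mul_eq {f s r : R} (hs : IsNilpotent s) (hsf : s * f = s)
    (hsr : s * r = f) : f = 0 := by
  obtain ⟨n, hn⟩ := hs
  have key (m : ℕ) : s ^ m * f = 0 → f = 0 := by
    induction m with
    | zero => simp
    | succ m ih =>
      intro hm
      apply ih
      rw [pow_succ, mul_assoc, hsf] at hm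
      rw [← hsr, ← mul_assoc, hm, zero_mul]
  exact key n (by rw [hn, zero_mul])

/-- In a UU ring, an idempotent which is a difference of two units vanishes. -/
theorem IsUURing.eq_zero_of_isIdempotentElem (h : IsUURing R) {f : R} (hf : IsIdempotentElem f)
    (v : Rˣ) (hu : IsUnit ((v : R) - f)) : f = 0 := by
  obtain ⟨w, hw⟩ : ∃ w : R, w = ((v⁻¹ : Rˣ) : R) := ⟨_, rfl⟩
  have hwv : w * v = 1 := by rw [hw, Units.inv_mul]
  have hff : f * f = f := hf
  have hff' (t : R) : f * (f * t) = f * t := by rw [← mul_assoc, hff]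
  have hwf : IsNilpotent (w * f) := by
    have := h.isNilpotent_sub_one ((hw ▸ (v⁻¹).isUnit : IsUnit w).mul hu)
    rwa [mul_sub, hwv, sub_sub_cancel_left, isNilpotent_neg_iff] at this
  have hs : IsNilpotent (f * w * f) := by
    obtain ⟨n, hn⟩ := hwf
    have hpow (m : ℕ) : (f * w * f) ^ (m + 1) = f * (w * f) ^ (m + 1) := by
      induction m with
      | zero => simp [mul_assoc]
      | succ m ih =>
        rw [pow_succ, ih, pow_succ (w * f) (m + 1), pow_succ (w * f) m]
        simp only [mul_assoc, hff']
    exact ⟨n + 1, by rw [hpow, pow_succ, hn, zero_mul, mul_zero]⟩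
  obtain ⟨z, hz⟩ : ∃ z : R, z = f * w * (1 - f) * ((1 - f) * v * f) := ⟨_, rfl⟩
  have hz_nil : IsNilpotent z := by
    rw [hz]
    apply h.isNilpotent_mul_of_mul_self_eq_zero <;>
      simp [mul_sub, sub_mul, mul_assoc, hff']
  have hwv' (t : R) : w * (v * t) = t := by rw [← mul_assoc, hwv, one_mul]
  have hzf : f * w * f * (f * v * f) = f * (1 - z) := by
    simp [hz, mul_sub, sub_mul, mul_assoc, hff, hff', hwv']
  obtain ⟨g, hg⟩ := hz_nil.isUnit_one_sub.exists_right_inv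
  refine eq_zero_of_isNilpotent_of_mul_eq (r := f * v * f * g) hs ?_ ?_
  · rw [mul_assoc, hff]
  · rw [← mul_assoc, hzf, mul_assoc, hg, mul_one]

end UURing

/-- `R` is a UU ring iff every unit of `R` is uniquely nil-clean. -/
theorem stmt_12 (R : Type*) [Ring R] :
    IsUURing R ↔
      ∀ u : Rˣ, ∃! e : R, IsIdempotentElem e ∧ IsNilpotent ((u : R) - e) := by
  refine ⟨fun h u ↦ ⟨1, ⟨IsIdempotentElem.one, h.isNilpotent_sub_one u.isUnit⟩, ?_⟩,
    fun h u ↦ ?_⟩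
  · rintro e ⟨he, hq⟩
    obtain ⟨v, hv⟩ := hq.isUnit_one_add
    refine (sub_eq_zero.mp (h.eq_zero_of_isIdempotentElem he.one_sub v ?_)).symm
    rw [hv, show 1 + ((u : R) - e) - (1 - e) = u by abel]
    exact u.isUnit
  · obtain ⟨e, ⟨he, n, hn⟩, huniq⟩ := h u
    have hconj : (u : R) * e * ((u⁻¹ : Rˣ) : R) = e := by
      refine huniq _ ⟨?_, n, ?_⟩
      · rw [IsIdempotentElem]
        simp only [mul_assoc, Units.inv_mul_cancel_left]
        rw [← mul_assoc e e, he.eq]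
      · rw [show (u : R) - u * e * ((u⁻¹ : Rˣ) : R) = u * (u - e) * ((u⁻¹ : Rˣ) : R) by
          rw [mul_sub, sub_mul, Units.mul_inv_cancel_right], Units.conj_pow, hn]
        simp
    have hcomm : Commute (u : R) e := by
      rw [Units.mul_inv_eq_iff_eq_mul] at hconj
      exact hconj
    have hq : IsNilpotent ((u : R) - e) := ⟨n, hn⟩
    have heu : IsUnit e := by
      have := hq.neg.isUnit_add_left_of_commute u.isUnit
        ((Commute.refl (u : R)).sub_right hcomm).symm.neg_left
      rwa [show (u : R) + -(u - e) = e by abel] at this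
    have he1 : e = 1 := heu.mul_left_cancel (by rw [he.eq, mul_one])
    exact ⟨u - e, hq, by rw [he1, add_sub_cancel]⟩
end

section
/- A ring R is semipotent with U(R) = {1} (the only unit of R is 1) if and only if R is a Boolean ring. -/
/-- A ring is semipotent if for every `a ∉ J(R)` there is `x` with `ax` a
nonzero idempotent. -/
def IsSemipotentRing (R : Type*) [Ring R] : Prop :=
  ∀ a : R, a ∉ Ideal.jacobson (⊥ : Ideal R) →
    ∃ x : R, IsIdempotentElem (a * x) ∧ a * x ≠ 0

section TrivialUnits

variable {R : Type*} [Ring R]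

theorem eq_zero_of_mul_self_eq_zero_of_units (hU : ∀ u : Rˣ, u = 1) {n : R} (hn : n * n = 0) :
    n = 0 := by
  have h := congrArg Units.val (hU ⟨1 + n, 1 - n, by simp [mul_sub, add_mul, hn],
    by simp [sub_mul, mul_add, hn]⟩)
  simpa using h

theorem IsIdempotentElem.commute_of_units (hU : ∀ u : Rˣ, u = 1) {e : R}
    (he : IsIdempotentElem e) (x : R) : e * x = x * e := by
  have he' : e * e = e := he
  have h1 : e * x * (1 - e) = 0 := eq_zero_of_mul_self_eq_zero_of_units hU <| by
    calc e * x * (1 - e) * (e * x * (1 - e)) = e * x * (e - e * e) * x * (1 - e) := by noncomm_ring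
      _ = 0 := by simp [he']
  have h2 : (1 - e) * x * e = 0 := eq_zero_of_mul_self_eq_zero_of_units hU <| by
    calc (1 - e) * x * e * ((1 - e) * x * e) = (1 - e) * x * (e - e * e) * x * e := by noncomm_ring
      _ = 0 := by simp [he']
  have h3 : e * x = e * x * e := by simpa [mul_sub, sub_eq_zero] using h1
  have h4 : x * e = e * x * e := by simpa [sub_mul, sub_eq_zero] using h2
  rw [h3, ← h4]

theorem eq_one_of_mul_eq_one_of_units (hU : ∀ u : Rˣ, u = 1) {u v : R} (h : u * v = 1) :
    u = 1 := by
  have hf : IsIdempotentElem (v * u) := by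
    change v * u * (v * u) = v * u
    rw [mul_assoc, ← mul_assoc u, h, one_mul]
  have hvu : v * u = 1 := by
    calc v * u = v * u * (u * v) := by rw [h, mul_one]
      _ = u * (v * u) * v := by rw [← mul_assoc, hf.commute_of_units hU u]
      _ = (u * v) * (u * v) := by simp only [mul_assoc]
      _ = 1 := by rw [h, mul_one]
  exact congrArg Units.val (hU ⟨u, v, h, hvu⟩)

theorem jacobson_bot_eq_zero_of_units (hU : ∀ u : Rˣ, u = 1) {j : R}
    (hj : j ∈ Ideal.jacobson (⊥ : Ideal R)) : j = 0 := by
  obtain ⟨z, hz⟩ := Ideal.mem_jacobson_iff.1 hj 1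
  have h : z * (j + 1) = 1 := by
    simpa [mul_add, sub_eq_zero] using hz
  have hz1 := eq_one_of_mul_eq_one_of_units hU h
  simpa [hz1] using h

theorem IsIdempotentElem.mul_eq_self_of_units (hU : ∀ u : Rˣ, u = 1) {e : R}
    (he : IsIdempotentElem e) {a b : R} (hab : a * b = e) : e * a = e := by
  have he' : e * e = e := he
  have hc := he.commute_of_units hU
  have h : (e * a + (1 - e)) * (e * b + (1 - e)) = 1 := by
    have h1 : e * a * (e * b) = e := by
      rw [hc a, mul_assoc, ← mul_assoc e, he', hc b, ← mul_assoc, hab, he']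
    have h2 : e * a * (1 - e) = 0 := by
      rw [hc a, mul_assoc, mul_sub, he', mul_one, sub_self, mul_zero]
    have h3 : (1 - e) * (e * b) = 0 := by
      rw [← mul_assoc, sub_mul, he', one_mul, sub_self, zero_mul]
    rw [add_mul, mul_add, mul_add, h1, h2, h3, he.one_sub.eq]
    abel
  have := eq_one_of_mul_eq_one_of_units hU h
  rwa [add_sub, sub_eq_iff_eq_add, add_comm, add_left_cancel_iff] at this

end TrivialUnits

/-- `R` is semipotent with `U(R) = {1}` iff `R` is Boolean. -/
theorem stmt_14 (R : Type*) [Ring R] :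
    (IsSemipotentRing R ∧ ∀ u : Rˣ, u = 1) ↔ ∀ a : R, IsIdempotentElem a := by
  constructor
  · rintro ⟨hR, hU⟩ a
    by_contra ha
    have hne : a * (1 - a) ≠ 0 := fun h ↦ ha <| by
      rw [mul_sub, mul_one, sub_eq_zero] at h
      exact h.symm
    obtain ⟨x, he, he0⟩ := hR _ (mt (jacobson_bot_eq_zero_of_units hU) hne)
    have h1 := he.mul_eq_self_of_units hU (mul_assoc a (1 - a) x).symm
    have h2 := he.mul_eq_self_of_units hU (a := 1 - a) (b := a * x) (by noncomm_ring)
    rw [mul_sub, h1, mul_one, sub_self] at h2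
    exact he0 h2.symm
  · refine fun h ↦ ⟨fun a ha ↦ ⟨1, h _, ?_⟩, fun u ↦ ?_⟩
    · rintro h0
      rw [mul_one] at h0
      exact ha (h0 ▸ zero_mem _)
    · have hu : u * u = u := Units.ext (h u)
      simpa using hu
end

section
/- Let R be a ring in which 2 is nilpotent. The following are equivalent: (1) R is a strong UNII-ring; (2) every unit of R is the sum of a nilpotent b and a tripotent t (t³ = t) with bt = tb; (3) R is a UU ring. -/
/-- A ring is a strong UNII-ring if every unit is the sum of a nilpotent and two
idempotents that commute with one another. -/
def IsStrongUNIIRing (R : Type*) [Ring R] : Prop :=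
  ∀ u : Rˣ, ∃ b e f : R, IsNilpotent b ∧ IsIdempotentElem e ∧ IsIdempotentElem f ∧
    Commute b e ∧ Commute b f ∧ Commute e f ∧ (u : R) = b + e + f

/-- If a unit `u` is the sum of a nilpotent and a commuting element `s` with `s ^ 3 - s` nilpotent,
and `2` is nilpotent, then `u - 1` is nilpotent. -/
theorem isNilpotent_sub_one_of_isUnit_add {R : Type*} [Ring R] (h2 : IsNilpotent (2 : R))
    {b s : R} (hu : IsUnit (b + s)) (hb : IsNilpotent b) (hbs : Commute b s)
    (hs : IsNilpotent (s ^ 3 - s)) : IsNilpotent (b + s - 1) := by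
  have hsu : IsUnit s := by
    have h := hb.neg.isUnit_add_left_of_commute hu
      (((Commute.refl b).add_right hbs).neg_left)
    simpa [add_assoc] using h
  have hsq : IsNilpotent (s ^ 2 - 1) := by
    have hc : Commute (s ^ 2 - 1) s :=
      ((Commute.refl s).pow_left 2).sub_left (Commute.one_left s)
    refine (hsu.isNilpotent_mul_unit_of_commute_iff hc).mp ?_
    convert hs using 1
    noncomm_ring
  have hs1 : IsNilpotent (s - 1) := by
    have hc2 : Commute (2 : R) (s - 1) := Commute.ofNat_left 2 _
    have hc : Commute (s ^ 2 - 1) (2 * (s - 1)) := by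
      have h : Commute (s ^ 2) (s - 1) :=
        ((Commute.refl s).pow_left 2).sub_right (Commute.one_right _)
      exact (Commute.ofNat_right _ 2).mul_right (h.sub_left (Commute.one_left _))
    have h : IsNilpotent ((s - 1) ^ 2) := by
      convert hc.isNilpotent_sub hsq (hc2.isNilpotent_mul_right h2) using 1
      noncomm_ring
    exact h.of_pow
  rw [add_sub_assoc]
  exact (hbs.sub_right (Commute.one_right b)).isNilpotent_add hb hs1

/-- If `2` is nilpotent, so is `(e + f) ^ 3 - (e + f)` for commuting idempotents `e` and `f`. -/
theorem isNilpotent_add_pow_three_sub_add {R : Type*} [Ring R] (h2 : IsNilpotent (2 : R))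
    {e f : R} (he : IsIdempotentElem e) (hf : IsIdempotentElem f) (hef : Commute e f) :
    IsNilpotent ((e + f) ^ 3 - (e + f)) := by
  have hsq : (e + f) * (e + f) = e + f + 2 * (e * f) := by
    rw [mul_add, add_mul, add_mul, he.eq, hf.eq, ← hef.eq]
    noncomm_ring
  have h : (e + f) ^ 3 - (e + f) = 2 * (e * f * (e + f + 1)) := by
    calc (e + f) ^ 3 - (e + f)
        = ((e + f) * (e + f) - (e + f)) * (e + f + 1) := by noncomm_ring
      _ = 2 * (e * f * (e + f + 1)) := by rw [hsq, add_sub_cancel_left, mul_assoc]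
  rw [h]
  exact (Commute.ofNat_left 2 _).isNilpotent_mul_right h2

/-- For a ring with `2` nilpotent, TFAE: (1) `R` is a strong UNII-ring;
(2) every unit is the sum of a nilpotent and a tripotent that commute;
(3) `R` is a UU ring. -/
theorem stmt_15 (R : Type*) [Ring R] (h2 : IsNilpotent (2 : R)) :
    List.TFAE
      [IsStrongUNIIRing R,
       ∀ u : Rˣ, ∃ b t : R, IsNilpotent b ∧ t ^ 3 = t ∧ b * t = t * b ∧
         (u : R) = b + t,
       IsUURing R] := by
  tfae_have 1 → 3 := by
    intro h u
    obtain ⟨b, e, f, hb, he, hf, hbe, hbf, hef, hu⟩ := h u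
    rw [add_assoc] at hu
    exact ⟨u - 1, hu ▸ isNilpotent_sub_one_of_isUnit_add h2 (hu ▸ u.isUnit) hb
      (hbe.add_right hbf) (isNilpotent_add_pow_three_sub_add h2 he hf hef), by abel⟩
  tfae_have 2 → 3 := by
    intro h u
    obtain ⟨b, t, hb, ht, hbt, hu⟩ := h u
    exact ⟨u - 1, hu ▸ isNilpotent_sub_one_of_isUnit_add h2 (hu ▸ u.isUnit) hb hbt
      (by simp [ht]), by abel⟩
  tfae_have 3 → 1 := by
    intro h u
    obtain ⟨b, hb, hu⟩ := h u
    exact ⟨b, 1, 0, hb, .one, .zero, .one_right b, .zero_right b, .zero_right 1,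
      by rw [hu, add_zero, add_comm]⟩
  tfae_have 3 → 2 := by
    intro h u
    obtain ⟨b, hb, hu⟩ := h u
    exact ⟨b, 1, hb, one_pow 3, by simp, by rw [hu, add_comm]⟩
  tfae_finish
end

section
/- Let R be a ring in which 3 is nilpotent. The following are equivalent: (1) R is a strong UNII-ring; (2) every unit of R is the sum of a nilpotent b and a tripotent t (t³ = t) with bt = tb; (3) 1 − u² is nilpotent for every unit u of R. -/
/-- If `3` and `n` are nilpotent, then `1 + n` has finite `3`-power order. -/
theorem exists_one_add_pow_three_pow_eq_one {R : Type*} [Ring R] (h3 : IsNilpotent (3 : R))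
    {n : R} (hn : IsNilpotent n) : ∃ m : ℕ, (1 + n) ^ 3 ^ m = 1 := by
  obtain ⟨k, hk⟩ := h3
  obtain ⟨j, hj⟩ := hn
  have hj' : n ^ 3 ^ j = 0 := pow_eq_zero_of_le (Nat.lt_pow_self (by norm_num)).le hj
  obtain ⟨r, hr⟩ := exists_add_pow_prime_pow_eq Nat.prime_three
    (1 : Polynomial ℤ) Polynomial.X j
  have hdvd : ((3 : ℕ) : Polynomial ℤ) ∣
      (1 + Polynomial.X) ^ 3 ^ j - (1 + Polynomial.X ^ 3 ^ j) := by
    rw [hr, one_pow, add_sub_cancel_left, mul_assoc, mul_assoc]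
    exact dvd_mul_right _ _
  obtain ⟨q, hq⟩ := dvd_sub_pow_of_dvd_sub hdvd k
  have h := congrArg (Polynomial.aeval n) hq
  have h3k : (3 : R) ^ (k + 1) = 0 := by rw [pow_succ, hk, zero_mul]
  simp only [map_sub, map_pow, map_add, map_one, Polynomial.aeval_X, map_mul,
    hj', add_zero, one_pow, Nat.cast_ofNat, map_ofNat, h3k, zero_mul] at h
  refine ⟨j + k, ?_⟩
  rw [pow_add, pow_mul]
  exact sub_eq_zero.mp h

/-- If `3` and `1 - u ^ 2` are nilpotent, then `u` differs by a nilpotent from a square root of `1`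
that commutes with everything commuting with `u`. -/
theorem exists_sq_eq_one_of_isNilpotent_one_sub_sq {R : Type*} [Ring R]
    (h3 : IsNilpotent (3 : R)) {u : R} (hu : IsNilpotent (1 - u ^ 2)) :
    ∃ t : R, t ^ 2 = 1 ∧ Commute u t ∧ IsNilpotent (u - t) := by
  obtain ⟨m, hm⟩ := exists_one_add_pow_three_pow_eq_one h3 hu.neg
  have hodd : Odd (3 ^ m) := Odd.pow (by decide)
  obtain ⟨l, hl⟩ := hodd
  refine ⟨u ^ 3 ^ m, ?_, Commute.self_pow u _, ?_⟩
  · rw [← pow_mul, mul_comm, pow_mul, ← hm]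
    congr 1
    abel
  · have h : u - u ^ 3 ^ m = (1 - u ^ 2) * ((∑ i ∈ Finset.range l, (u ^ 2) ^ i) * u) := by
      rw [← mul_assoc, mul_neg_geom_sum, hl, pow_succ, pow_mul, sub_mul, one_mul]
    rw [h]
    refine Commute.isNilpotent_mul_right ?_ hu
    have hc : Commute (1 - u ^ 2) u :=
      (Commute.one_left u).sub_left (Commute.pow_self u 2)
    refine Commute.mul_right (Commute.sum_right _ _ _ fun i _ => ?_) hc
    exact (hc.pow_right 2).pow_right i

/-- If `x ^ 3 - x` is nilpotent for some `x` differing from the unit `u` by a commuting nilpotent,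
then `1 - u ^ 2` is nilpotent. -/
theorem isNilpotent_one_sub_sq_of_eq_add {R : Type*} [Ring R] {u : Rˣ} {b x : R}
    (hb : IsNilpotent b) (hx : IsNilpotent (x ^ 3 - x)) (hbx : Commute b x)
    (hu : (u : R) = b + x) : IsNilpotent (1 - (u : R) ^ 2) := by
  have hexp : (u : R) ^ 3 - u = b * (b ^ 2 + 3 * (b * x) + 3 * x ^ 2 - 1) + (x ^ 3 - x) := by
    have hxb : x * b = b * x := hbx.eq.symm
    have hxb' (y : R) : x * (b * y) = b * (x * y) := by rw [← mul_assoc, hxb, mul_assoc]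
    have h3 : (3 : R) = 1 + 1 + 1 := by norm_num
    rw [hu, h3]
    simp only [pow_succ, pow_zero, one_mul, mul_add, add_mul, mul_sub, mul_one, mul_assoc, hxb,
      hxb']
    abel
  have hb3 : Commute b 3 := Nat.cast_ofNat (R := R) (n := 3) ▸ Nat.commute_cast b 3
  have hx3 : Commute x 3 := Nat.cast_ofNat (R := R) (n := 3) ▸ Nat.commute_cast x 3
  have hbp : Commute b (b ^ 2 + 3 * (b * x) + 3 * x ^ 2 - 1) :=
    ((((Commute.self_pow b 2).add_right (hb3.mul_right ((Commute.refl b).mul_right hbx))).add_right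
      (hb3.mul_right (hbx.pow_right 2))).sub_right (Commute.one_right b))
  have hxp : Commute x (b ^ 2 + 3 * (b * x) + 3 * x ^ 2 - 1) :=
    ((((hbx.symm.pow_right 2).add_right
      (hx3.mul_right (hbx.symm.mul_right (Commute.refl x)))).add_right
      (hx3.mul_right (Commute.self_pow x 2))).sub_right (Commute.one_right x))
  have hxy : Commute x (b * (b ^ 2 + 3 * (b * x) + 3 * x ^ 2 - 1)) := hbx.symm.mul_right hxp
  have hnil : IsNilpotent ((u : R) ^ 3 - u) := by
    rw [hexp]
    exact Commute.isNilpotent_add ((hxy.pow_left 3).sub_left hxy).symm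
      (hbp.isNilpotent_mul_right hb) hx
  have hfac : 1 - (u : R) ^ 2 = -(((u : R) ^ 3 - u) * (↑u⁻¹ : R)) := by
    rw [sub_mul, pow_succ (u : R) 2, Units.mul_inv_cancel_right, Units.mul_inv, neg_sub]
  have hcomm : Commute ((u : R) ^ 3 - u) (↑u⁻¹ : R) := by
    have h : Commute (u : R) (↑u⁻¹ : R) := (Commute.refl (u : R)).units_inv_right
    exact (h.pow_left 3).sub_left h
  rw [hfac]
  exact (hcomm.isNilpotent_mul_right hnil).neg

/-- If `3` is nilpotent, then `s ^ 3 - s` is nilpotent for every sum `s` of two commuting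
idempotents. -/
theorem isNilpotent_cube_sub_self_of_isIdempotentElem {R : Type*} [Ring R]
    (h3 : IsNilpotent (3 : R)) {e f : R} (he : IsIdempotentElem e) (hf : IsIdempotentElem f)
    (hef : Commute e f) : IsNilpotent ((e + f) ^ 3 - (e + f)) := by
  have hexp : (e + f) ^ 3 - (e + f) = 3 * (2 * (e * f)) := by
    have hee : e * e = e := he
    have hff : f * f = f := hf
    have hfe : f * e = e * f := hef.eq.symm
    have hee' (y : R) : e * (e * y) = e * y := by rw [← mul_assoc, hee]
    have h2' : (2 : R) = 1 + 1 := by norm_num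
    have h3' : (3 : R) = 1 + 1 + 1 := by norm_num
    rw [h2', h3']
    simp only [pow_succ, pow_zero, one_mul, mul_add, add_mul, mul_assoc, hfe, hee, hff, hee']
    abel
  rw [hexp]
  have hc : Commute (3 : R) (2 * (e * f)) :=
    Nat.cast_ofNat (R := R) (n := 3) ▸ Nat.cast_commute 3 (2 * (e * f))
  exact hc.isNilpotent_mul_right h3

/-- If `3` is nilpotent, then `2` is invertible, with inverse a natural number. -/
theorem exists_two_mul_natCast_eq_one {R : Type*} [Ring R] (h3 : IsNilpotent (3 : R)) :
    ∃ c : ℕ, 2 * (c : R) = 1 := by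
  obtain ⟨k, hk⟩ := h3
  have hodd : Odd (3 ^ k) := Odd.pow (by decide)
  obtain ⟨l, hl⟩ := hodd
  refine ⟨l + 1, ?_⟩
  have h : (((2 * l + 1 : ℕ)) : R) = 0 := by rw [← hl]; exact_mod_cast hk
  have h' : (2 : R) * ((l + 1 : ℕ) : R) = ((2 * l + 1 : ℕ) : R) + 1 := by
    norm_cast
  rw [h', h, zero_add]

/-- For a ring with `3` nilpotent, TFAE: (1) `R` is a strong UNII-ring;
(2) every unit is the sum of a nilpotent and a tripotent that commute;
(3) `1 - u²` is nilpotent for every unit `u`. -/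
theorem stmt_16 (R : Type*) [Ring R] (h3 : IsNilpotent (3 : R)) :
    List.TFAE
      [IsStrongUNIIRing R,
       ∀ u : Rˣ, ∃ b t : R, IsNilpotent b ∧ t ^ 3 = t ∧ b * t = t * b ∧
         (u : R) = b + t,
       ∀ u : Rˣ, IsNilpotent (1 - (u : R) ^ 2)] := by
  tfae_have 1 → 3 := by
    intro h u
    obtain ⟨b, e, f, hb, he, hf, hbe, hbf, hef, hu⟩ := h u
    exact isNilpotent_one_sub_sq_of_eq_add hb
      (isNilpotent_cube_sub_self_of_isIdempotentElem h3 he hf hef) (hbe.add_right hbf)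
      (by rw [hu, add_assoc])
  tfae_have 2 → 3 := by
    intro h u
    obtain ⟨b, t, hb, ht, hbt, hu⟩ := h u
    exact isNilpotent_one_sub_sq_of_eq_add hb (by rw [ht, sub_self]; exact IsNilpotent.zero) hbt hu
  tfae_have 3 → 2 := by
    intro h u
    obtain ⟨t, ht, hut, hn⟩ := exists_sq_eq_one_of_isNilpotent_one_sub_sq h3 (h u)
    exact ⟨u - t, t, hn, by rw [pow_succ, ht, one_mul], (hut.sub_left (Commute.refl t)).eq,
      (sub_add_cancel _ _).symm⟩
  tfae_have 3 → 1 := by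
    intro h u
    obtain ⟨t, ht, hut, hn⟩ := exists_sq_eq_one_of_isNilpotent_one_sub_sq h3 (h u)
    obtain ⟨c, hc⟩ := exists_two_mul_natCast_eq_one h3
    have hf2 : 2 * ((c : R) * (1 - t)) = 1 - t := by rw [← mul_assoc, hc, one_mul]
    have hcomm {x : R} (hx : Commute x t) : Commute x ((c : R) * (1 - t)) :=
      (Nat.commute_cast x c).mul_right ((Commute.one_right x).sub_right hx)
    have hc3 (x : R) : Commute 3 x := Nat.cast_ofNat (R := R) (n := 3) ▸ Nat.cast_commute 3 x
    have hut' : Commute ((u : R) - t) t := hut.sub_left (Commute.refl t)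
    have hbf : Commute ((u : R) - t - 3 * ((c : R) * (1 - t))) ((c : R) * (1 - t)) :=
      (hcomm hut').sub_left ((hc3 _).mul_left (Commute.refl _))
    refine ⟨u - t - 3 * ((c : R) * (1 - t)), 1, (c : R) * (1 - t), ?_, IsIdempotentElem.one, ?_,
      Commute.one_right _, hbf, Commute.one_left _, ?_⟩
    · exact Commute.isNilpotent_sub ((hc3 _).symm.mul_right (hcomm hut')) hn
        ((hc3 _).isNilpotent_mul_right h3)
    · have hsq : (1 - t) * (1 - t) = 2 * (1 - t) := by
        rw [pow_two] at ht
        rw [mul_sub, mul_one, sub_mul, one_mul, ht, two_mul]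
        abel
      have hct : (1 - t) * (c : R) = (c : R) * (1 - t) := (Nat.commute_cast _ c).eq
      calc (c : R) * (1 - t) * ((c : R) * (1 - t))
          = (c : R) * ((c : R) * ((1 - t) * (1 - t))) := by
            rw [mul_assoc, ← mul_assoc (1 - t), hct, mul_assoc]
        _ = (c : R) * (1 - t) := by
            rw [hsq, ← mul_assoc (c : R) 2, (Nat.cast_commute c (2 : R)).eq, hc, one_mul]
    · have h32 : 3 * ((c : R) * (1 - t)) = (1 - t) + (c : R) * (1 - t) := by
        rw [← hf2, ← mul_assoc 2, hc, one_mul, ← two_add_one_eq_three, add_mul, one_mul, hf2]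
      rw [h32]
      abel
  tfae_finish
end

section
/- A ring R is a strong UII-ring with 2 = 0 in R if and only if 1 is the only unit of R, i.e., U(R) = {1}. -/
/-- A ring is a strong UII-ring if every unit is the sum of two commuting
idempotents. -/
def IsStrongUIIRing (R : Type*) [Ring R] : Prop :=
  ∀ u : Rˣ, ∃ e f : R, IsIdempotentElem e ∧ IsIdempotentElem f ∧
    Commute e f ∧ (u : R) = e + f

/-- `R` is a strong UII-ring with `2 = 0` iff `U(R) = {1}`. -/
theorem stmt_18 (R : Type*) [Ring R] :
    (IsStrongUIIRing R ∧ (2 : R) = 0) ↔ ∀ u : Rˣ, u = 1 := by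
  constructor
  · rintro ⟨h, h2⟩ u
    obtain ⟨e, f, he, hf, hef, hu⟩ := h u
    have hsq : (u : R) * u = u := by
      rw [hu, add_mul, mul_add, mul_add, he.eq, hf.eq, ← hef.eq]
      calc e + e * f + (e * f + f) = e + f + 2 * (e * f) := by rw [two_mul]; abel
        _ = e + f := by rw [h2, zero_mul, add_zero]
    exact mul_eq_left.mp (Units.ext hsq : u * u = u)
  · intro h
    refine ⟨fun u ↦ ⟨1, 0, .one, .zero, .zero_right 1, by simp [h u]⟩, ?_⟩
    have hneg : (-1 : R) = 1 := congrArg Units.val (h (-1))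
    calc (2 : R) = 1 + 1 := one_add_one_eq_two.symm
      _ = -1 + 1 := by rw [hneg]
      _ = 0 := neg_add_cancel 1
end

section
/- A ring R is a strong UII-ring with 3 = 0 in R if and only if U(R) = 1 + idem(R), that is, an element u of R is a unit if and only if u = 1 + e for some idempotent e of R. -/
/-- If a unit is the sum of two commuting idempotents `e` and `f`, it equals `1 + e * f`. -/
theorem IsUnit.eq_one_add_mul_of_eq_add {R : Type*} [Ring R] {u e f : R} (hu : IsUnit u)
    (he : IsIdempotentElem e) (hf : IsIdempotentElem f) (hef : Commute e f)
    (h : u = e + f) : u = 1 + e * f := by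
  have hz : (1 - e) * (1 - f) * u = 0 := by
    have h₁ : (1 - f) * e = e * (1 - f) := by
      rw [sub_mul, mul_sub, one_mul, mul_one, hef.eq]
    rw [h, mul_add, mul_assoc, h₁, ← mul_assoc, he.one_sub_mul_self, zero_mul,
      mul_assoc, hf.one_sub_mul_self, mul_zero, add_zero]
  have h₂ : (1 - e) * (1 - f) = 0 := (hu.mul_left_eq_zero).1 hz
  rw [h, ← sub_eq_zero, ← neg_eq_zero, ← h₂]
  noncomm_ring

/-- `R` is a strong UII-ring with `3 = 0` iff `U(R) = 1 + idem(R)`, i.e. an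
element is a unit iff it is `1 + e` for some idempotent `e`. -/
theorem stmt_19 (R : Type*) [Ring R] :
    (IsStrongUIIRing R ∧ (3 : R) = 0) ↔
      ∀ u : R, IsUnit u ↔ ∃ e : R, IsIdempotentElem e ∧ u = 1 + e := by
  constructor
  · rintro ⟨hR, h3⟩ u
    constructor
    · intro hu
      obtain ⟨e, f, he, hf, hef, h⟩ := hR hu.unit
      exact ⟨e * f, he.mul_of_commute hef hf, hu.eq_one_add_mul_of_eq_add he hf hef h⟩
    · rintro ⟨e, he, rfl⟩
      have h : (1 + e) * (1 + e) = 1 := by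
        calc (1 + e) * (1 + e) = 1 + e + e + e * e := by noncomm_ring
          _ = 1 + 3 * e := by rw [he.eq]; noncomm_ring
          _ = 1 := by rw [h3, zero_mul, add_zero]
      exact ⟨⟨1 + e, 1 + e, h, h⟩, rfl⟩
  · intro h
    refine ⟨fun u => ?_, ?_⟩
    · obtain ⟨e, he, hu⟩ := (h u).1 u.isUnit
      exact ⟨1, e, IsIdempotentElem.one, he, Commute.one_left e, hu⟩
    · have h2 : IsUnit (2 : R) :=
        (h 2).2 ⟨1, IsIdempotentElem.one, one_add_one_eq_two.symm⟩
      obtain ⟨e, he, h1⟩ := (h (-1)).1 isUnit_one.neg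
      obtain rfl : e = -2 := by
        rw [← sub_eq_iff_eq_add'] at h1
        rw [← h1]
        norm_num
      have h6 : (2 : R) * 3 = 0 := by
        have h4 : (-2 : R) * -2 - -2 = 0 := sub_eq_zero.2 he.eq
        rw [← h4]
        norm_num
      exact (h2.mul_right_eq_zero).1 h6
end
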